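/- Let γ ∈ (−3,−2), let k > (γ+3)/2 and set m(v) = ⟨v⟩^k, and let α satisfy 0 ≤ α < k − (γ+3)/2 with ω(v) = ⟨v⟩^α. Then limsup_{|v|→∞} (ζ̃_m(v) + ζ_{m,ω}(v)) ⟨v⟩^{−γ} ≤ 2((γ+3)/2 + α − k). -/

import Mathlib

noncomputable section

open MeasureTheory Real Filter

abbrev V3 := EuclideanSpace ℝ (Fin 3)

/-- Japanese bracket ⟨v⟩ = (1+|v|²)^{1/2}. -/
def jap (v : V3) : ℝ := Real.sqrt (1 + ‖v‖ ^ 2)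

/-- Standard Gaussian μ on ℝ³. -/
def gaussM (v : V3) : ℝ := (2 * Real.pi) ^ (-(3 : ℝ) / 2) * Real.exp (-‖v‖ ^ 2 / 2)

/-- Landau kernel matrix a_{ij}(z). -/
def aker (γ : ℝ) (z : V3) (i j : Fin 3) : ℝ :=
  ‖z‖ ^ (γ + 2) * ((if i = j then (1 : ℝ) else 0) - z i * z j / ‖z‖ ^ 2)

/-- ā_{ij} = a_{ij} * μ. -/
def abar (γ : ℝ) (v : V3) (i j : Fin 3) : ℝ := ∫ w : V3, aker γ (v - w) i j * gaussM w

def bker (γ : ℝ) (z : V3) (i : Fin 3) : ℝ := -2 * ‖z‖ ^ γ * z i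

/-- b̄_i = b_i * μ. -/
def bbar (γ : ℝ) (v : V3) (i : Fin 3) : ℝ := ∫ w : V3, bker γ (v - w) i * gaussM w

/-- J_β(v) = ∫ |v−w|^β μ(w) dw. -/
def Jfun (β : ℝ) (v : V3) : ℝ := ∫ w : V3, ‖v - w‖ ^ β * gaussM w

/-- c̄(v) = −2(γ+3) J_γ(v). -/
def cbar (γ : ℝ) (v : V3) : ℝ := -2 * (γ + 3) * Jfun γ v

/-- ℓ₁(v). -/
def ell1 (γ : ℝ) (v : V3) : ℝ :=
  ∫ w : V3, (1 - ((∑ i, v i * w i) / (‖v‖ * ‖w‖)) ^ 2) * ‖w‖ ^ (γ + 2) * gaussM (v - w)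

/-- Squared Euclidean norm of the cross product of two vectors in ℝ³. -/
def crossSq (a b : V3) : ℝ :=
  ∑ i, (crossProduct (R := ℝ) (fun k => a k) (fun k => b k) i) ^ 2

/-- ℓ₂(v). -/
def ell2 (γ : ℝ) (v : V3) : ℝ :=
  ∫ w : V3,
    (1 - (1 / 2) * crossSq (‖v‖⁻¹ • v) (‖w‖⁻¹ • w)) * ‖w‖ ^ (γ + 2) * gaussM (v - w)

/-- Projection P_v ξ on the direction v. -/
def Pv (v ξ : V3) : V3 := ((∑ i, ξ i * v i) / ‖v‖ ^ 2) • v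

/-- Partial derivative in the i-th coordinate direction. -/
def pd (i : Fin 3) (f : V3 → ℝ) : V3 → ℝ := fun v => fderiv ℝ f v (EuclideanSpace.single i 1)

/-- Anisotropic gradient ∇̃f = P_v ∇f + ⟨v⟩ (I − P_v) ∇f. -/
def anisoGrad (f : V3 → ℝ) (v : V3) : V3 :=
  Pv v (gradient f v) + jap v • (gradient f v - Pv v (gradient f v))

/-- The filter |v| → ∞ on ℝ³. -/
def normAtTop : Filter V3 := Filter.comap (fun v : V3 => ‖v‖) Filter.atTop

/-- ζ_m(v) = Σ ā_{ij} ∂_{ij}m/m + Σ ā_{ij} (∂_i m/m)(∂_j m/m) + 2 Σ b̄_i ∂_i m/m − c̄/2. -/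
def zeta (γ : ℝ) (m : V3 → ℝ) (v : V3) : ℝ :=
  (∑ i, ∑ j, abar γ v i j * pd i (pd j m) v / m v)
  + (∑ i, ∑ j, abar γ v i j * (pd i m v / m v) * (pd j m v / m v))
  + 2 * (∑ i, bbar γ v i * pd i m v / m v)
  - cbar γ v / 2

/-- ζ̃_m(v) = Σ ā_{ij} (∂_i m/m)(∂_j m/m) + Σ b̄_i ∂_i m/m − c̄/2. -/
def zetaT (γ : ℝ) (m : V3 → ℝ) (v : V3) : ℝ :=
  (∑ i, ∑ j, abar γ v i j * (pd i m v / m v) * (pd j m v / m v))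
  + (∑ i, bbar γ v i * pd i m v / m v)
  - cbar γ v / 2

/-- ζ_{m,ω}(v). -/
def zetaMW (γ : ℝ) (m ω : V3 → ℝ) (v : V3) : ℝ :=
  (∑ i, ∑ j, abar γ v i j * pd i (pd j ω) v / ω v)
  + (∑ i, ∑ j, abar γ v i j * (pd i ω v / ω v) * (pd j ω v / ω v))
  - 2 * (∑ i, ∑ j, abar γ v i j * (pd i ω v / ω v) * (pd j m v / m v))

open scoped Topology

theorem normAtTop_eq_cobounded : normAtTop = Bornology.cobounded V3 := by
  rw [normAtTop, comap_norm_atTop]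

instance : normAtTop.NeBot := by
  rw [normAtTop_eq_cobounded]; infer_instance

instance : normAtTop.IsCountablyGenerated := by
  rw [normAtTop]; infer_instance

theorem tendsto_norm_normAtTop : Tendsto (fun v : V3 => ‖v‖) normAtTop atTop :=
  tendsto_comap

theorem integrable_norm_rpow_unitBall {β : ℝ} (hβ : -3 < β) :
    Integrable (fun z : V3 => if ‖z‖ < 1 then ‖z‖ ^ β else 0) := by
  rw [integrable_fun_norm_addHaar (volume : Measure V3)
    (f := fun y : ℝ => if y < 1 then y ^ β else 0)]
  have h : IntegrableOn (fun y : ℝ => y ^ (β + 2)) (Set.Ioo 0 1) :=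
    (intervalIntegral.integrableOn_Ioo_rpow_iff one_pos).2 (by linarith)
  have h2 : IntegrableOn ((Set.Ioo (0 : ℝ) 1).indicator fun y : ℝ => y ^ (β + 2)) (Set.Ioi 0) :=
    ((integrable_indicator_iff measurableSet_Ioo).2 h).integrableOn
  refine h2.congr_fun (fun y hy => ?_) measurableSet_Ioi
  have hy' : (0 : ℝ) < y := hy
  by_cases h1 : y < 1
  · rw [Set.indicator_of_mem (Set.mem_Ioo.2 ⟨hy', h1⟩), Real.rpow_add hy']
    simp [h1, mul_comm]
  · rw [Set.indicator_of_notMem (fun h => h1 h.2)]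
    simp [h1]

section RieszPotential

variable {β C : ℝ} {f : V3 → ℝ}

theorem integrable_riesz_near (hβ : -3 < β) (hf : Measurable f)
    (hC : ∀ w, |f w| ≤ C * (1 + ‖w‖) ^ (-7 : ℝ)) (v : V3) :
    Integrable (fun w => (if ‖v - w‖ < 1 then ‖v - w‖ ^ β else 0) * f w) := by
  refine ((integrable_norm_rpow_unitBall hβ).comp_sub_left v).mul_bdd (c := C)
    hf.aestronglyMeasurable (ae_of_all _ fun w => ?_)
  have h0 : (0 : ℝ) < (1 + ‖w‖) ^ (-7 : ℝ) := by positivity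
  have hC0 : 0 ≤ C := by
    by_contra h
    nlinarith [hC w, abs_nonneg (f w), mul_neg_of_neg_of_pos (not_le.1 h) h0]
  have h1 : (1 + ‖w‖) ^ (-7 : ℝ) ≤ 1 :=
    Real.rpow_le_one_of_one_le_of_nonpos (by linarith [norm_nonneg w]) (by norm_num)
  rw [Real.norm_eq_abs]
  nlinarith [hC w]

theorem integrable_riesz_far (hβ0 : β ≤ 0) (hf : Measurable f)
    (hC : ∀ w, |f w| ≤ C * (1 + ‖w‖) ^ (-7 : ℝ)) (v : V3) :
    Integrable (fun w => (if ‖v - w‖ < 1 then 0 else ‖v - w‖ ^ β) * f w) := by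
  have hg : Integrable (fun w : V3 => C * (1 + ‖w‖) ^ (-7 : ℝ)) :=
    (integrable_one_add_norm (by simp; norm_num)).const_mul C
  refine hg.mono' ?_ (ae_of_all _ fun w => ?_)
  · refine Measurable.aestronglyMeasurable (Measurable.mul ?_ hf)
    exact Measurable.ite (measurableSet_lt (by fun_prop) (by fun_prop)) (by fun_prop) (by fun_prop)
  · rw [norm_mul, Real.norm_eq_abs, Real.norm_eq_abs]
    refine le_trans ?_ (hC w)
    refine mul_le_of_le_one_left (abs_nonneg _) ?_
    split_ifs with h
    · simp
    · rw [abs_of_nonneg (by positivity)]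
      exact Real.rpow_le_one_of_one_le_of_nonpos (not_lt.1 h) hβ0

theorem integrable_riesz (hβ : -3 < β) (hβ0 : β ≤ 0) (hf : Measurable f)
    (hC : ∀ w, |f w| ≤ C * (1 + ‖w‖) ^ (-7 : ℝ)) (v : V3) :
    Integrable (fun w => ‖v - w‖ ^ β * f w) := by
  refine ((integrable_riesz_near hβ hf hC v).add (integrable_riesz_far hβ0 hf hC v)).congr
    (ae_of_all _ fun w => ?_)
  simp only [Pi.add_apply]
  split_ifs <;> ring

theorem tendsto_riesz_near (hβ : -3 < β)
    (hC : ∀ w, |f w| ≤ C * (1 + ‖w‖) ^ (-7 : ℝ)) :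
    Tendsto (fun v : V3 => ‖v‖ ^ (-β) *
      ∫ w, (if ‖v - w‖ < 1 then ‖v - w‖ ^ β else 0) * f w) normAtTop (𝓝 0) := by
  have hC0 : 0 ≤ C := by
    have := hC 0
    simp at this
    linarith [abs_nonneg (f 0)]
  set I := ∫ z : V3, (if ‖z‖ < 1 then ‖z‖ ^ β else 0) with hI
  have hlim : Tendsto (fun v : V3 => C * I * ‖v‖ ^ (-(β + 7))) normAtTop (𝓝 0) := by
    have := ((tendsto_rpow_neg_atTop (by linarith : 0 < β + 7)).comp
      tendsto_norm_normAtTop).const_mul (C * I)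
    simpa using this
  refine squeeze_zero_norm' ?_ hlim
  filter_upwards [tendsto_norm_normAtTop.eventually_gt_atTop 0] with v hv
  have hb : ‖∫ w, (if ‖v - w‖ < 1 then ‖v - w‖ ^ β else 0) * f w‖ ≤
      ∫ w, (if ‖v - w‖ < 1 then ‖v - w‖ ^ β else 0) * (C * ‖v‖ ^ (-7 : ℝ)) := by
    refine norm_integral_le_of_norm_le
      (((integrable_norm_rpow_unitBall hβ).comp_sub_left v).mul_const _) (ae_of_all _ fun w => ?_)
    split_ifs with h
    · rw [norm_mul, Real.norm_eq_abs, Real.norm_eq_abs, abs_of_nonneg (by positivity)]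
      refine mul_le_mul_of_nonneg_left ((hC w).trans ?_) (by positivity)
      refine mul_le_mul_of_nonneg_left ?_ hC0
      refine Real.rpow_le_rpow_of_nonpos hv ?_ (by norm_num)
      have := norm_add_le (v - w) w
      rw [sub_add_cancel] at this
      linarith
    · simp
  rw [integral_mul_const, integral_sub_left_eq_self
    (fun z : V3 => if ‖z‖ < 1 then ‖z‖ ^ β else 0) volume v, ← hI] at hb
  rw [norm_mul, Real.norm_of_nonneg (by positivity : 0 ≤ ‖v‖ ^ (-β))]
  calc ‖v‖ ^ (-β) * _ ≤ ‖v‖ ^ (-β) * (I * (C * ‖v‖ ^ (-7 : ℝ))) := by gcongr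
    _ = C * I * ‖v‖ ^ (-(β + 7)) := by
      rw [neg_add, Real.rpow_add hv]; ring

theorem tendsto_norm_sub_div_norm (w : V3) :
    Tendsto (fun v : V3 => ‖v - w‖ / ‖v‖) normAtTop (𝓝 1) := by
  rw [tendsto_iff_norm_sub_tendsto_zero]
  refine squeeze_zero' (Eventually.of_forall fun _ => norm_nonneg _) ?_
    (tendsto_norm_normAtTop.const_div_atTop ‖w‖)
  filter_upwards [tendsto_norm_normAtTop.eventually_gt_atTop 0] with v hv
  rw [div_sub_one hv.ne', norm_div, norm_norm]
  gcongr
  have := abs_norm_sub_norm_le (v - w) v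
  simpa using this

theorem tendsto_norm_sub_normAtTop (w : V3) :
    Tendsto (fun v : V3 => ‖v - w‖) normAtTop atTop := by
  refine tendsto_atTop_mono (fun v => ?_)
    (tendsto_atTop_add_const_right _ (-‖w‖) tendsto_norm_normAtTop)
  have := norm_sub_norm_le v w
  linarith

theorem tendsto_riesz_far (hβ : -3 < β) (hβ0 : β ≤ 0) (hf : Measurable f)
    (hC : ∀ w, |f w| ≤ C * (1 + ‖w‖) ^ (-7 : ℝ)) :
    Tendsto (fun v : V3 => ‖v‖ ^ (-β) *
      ∫ w, (if ‖v - w‖ < 1 then 0 else ‖v - w‖ ^ β) * f w) normAtTop (𝓝 (∫ w, f w)) := by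
  have hg : Integrable (fun w : V3 => C * (1 + ‖w‖) ^ (-(7 + β))) :=
    (integrable_one_add_norm (by simp; linarith)).const_mul C
  simp_rw [← integral_const_mul]
  refine tendsto_integral_filter_of_dominated_convergence _ ?_ ?_ hg ?_
  · exact Eventually.of_forall fun v =>
      ((integrable_riesz_far hβ0 hf hC v).const_mul _).aestronglyMeasurable
  · filter_upwards [tendsto_norm_normAtTop.eventually_gt_atTop 0] with v hv
    refine ae_of_all _ fun w => ?_
    have hw : 0 < 1 + ‖w‖ := by positivity
    have e : C * (1 + ‖w‖) ^ (-(7 + β)) = (1 + ‖w‖) ^ (-β) * (C * (1 + ‖w‖) ^ (-7 : ℝ)) := by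
      rw [neg_add, Real.rpow_add hw]; ring
    rw [e, ← mul_assoc, norm_mul]
    refine mul_le_mul ?_ (hC w) (abs_nonneg _) (by positivity)
    split_ifs with h
    · simp; positivity
    · have h1 := not_lt.1 h
      have hz : 0 < ‖v - w‖ := by linarith
      rw [Real.norm_of_nonneg (by positivity), ← neg_neg β, Real.rpow_neg hz.le (-β), neg_neg,
        ← div_eq_mul_inv, div_le_iff₀ (by positivity), ← Real.mul_rpow hw.le hz.le]
      refine Real.rpow_le_rpow hv.le ?_ (by linarith)
      have := norm_add_le (v - w) w
      rw [sub_add_cancel] at this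
      nlinarith [norm_nonneg w]
  · refine ae_of_all _ fun w => ?_
    have h1 : Tendsto (fun v : V3 => (‖v - w‖ / ‖v‖) ^ β * f w) normAtTop (𝓝 (f w)) := by
      have := ((tendsto_norm_sub_div_norm w).rpow_const (p := β) (Or.inl one_ne_zero)).mul_const (f w)
      simpa using this
    refine h1.congr' ?_
    filter_upwards [tendsto_norm_normAtTop.eventually_gt_atTop 0,
      (tendsto_norm_sub_normAtTop w).eventually_ge_atTop 1] with v hv hvw
    rw [if_neg (not_lt.2 hvw), Real.div_rpow (by positivity) (by positivity),
      Real.rpow_neg (by positivity)]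
    ring

theorem tendsto_riesz (hβ : -3 < β) (hβ0 : β ≤ 0) (hf : Measurable f)
    (hC : ∀ w, |f w| ≤ C * (1 + ‖w‖) ^ (-7 : ℝ)) :
    Tendsto (fun v : V3 => ‖v‖ ^ (-β) * ∫ w, ‖v - w‖ ^ β * f w) normAtTop (𝓝 (∫ w, f w)) := by
  have h := (tendsto_riesz_near hβ hC).add (tendsto_riesz_far hβ hβ0 hf hC)
  rw [zero_add] at h
  refine h.congr fun v => ?_
  rw [← mul_add, ← integral_add (integrable_riesz_near hβ hf hC v)
    (integrable_riesz_far hβ0 hf hC v)]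
  congr 2 with w
  split_ifs <;> ring

end RieszPotential

theorem gaussM_nonneg (w : V3) : 0 ≤ gaussM w := by
  unfold gaussM; positivity

@[fun_prop]
theorem measurable_gaussM : Measurable gaussM := by
  unfold gaussM; fun_prop

theorem integral_gaussM : ∫ w, gaussM w = 1 := by
  have h := GaussianFourier.integral_rexp_neg_mul_sq_norm (V := V3) (b := 1 / 2) (by norm_num)
  have hE : ∀ w : V3, gaussM w =
      (2 * π) ^ (-(3 : ℝ) / 2) * rexp (-(1 / 2) * ‖w‖ ^ 2) := fun w => by
    unfold gaussM; congr 2; ring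
  simp_rw [hE]
  rw [integral_const_mul, h, show π / (1 / 2) = 2 * π by ring,
    ← Real.rpow_add (by positivity)]
  simp
  norm_num

theorem exists_gaussM_decay : ∃ C : ℝ, ∀ p : ℕ, p ≤ 2 → ∀ w : V3,
    |‖w‖ ^ p * gaussM w| ≤ C * (1 + ‖w‖) ^ (-7 : ℝ) := by
  set A : ℝ := (2 * π) ^ (-(3 : ℝ) / 2) with hA
  have hA0 : 0 ≤ A := by positivity
  refine ⟨A * (Nat.factorial 9 * rexp (3 / 2)), fun p hp w => ?_⟩
  have hw : 0 < 1 + ‖w‖ := by positivity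
  rw [abs_of_nonneg (mul_nonneg (by positivity) (gaussM_nonneg w)), Real.rpow_neg hw.le,
    ← div_eq_mul_inv, le_div_iff₀ (by positivity),
    show (7 : ℝ) = ((7 : ℕ) : ℝ) by norm_num, Real.rpow_natCast]
  have h1 : ‖w‖ ^ p ≤ (1 + ‖w‖) ^ 2 :=
    (pow_le_pow_left₀ (norm_nonneg w) (by linarith) p).trans
      (pow_le_pow_right₀ (by linarith [norm_nonneg w]) hp)
  have h2 : (1 + ‖w‖) ^ 9 ≤ Nat.factorial 9 * rexp (1 + ‖w‖) := by
    have := Real.pow_div_factorial_le_exp (1 + ‖w‖) hw.le 9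
    rwa [div_le_iff₀' (by positivity)] at this
  have h3 : rexp (1 + ‖w‖) * rexp (-‖w‖ ^ 2 / 2) ≤ rexp (3 / 2) := by
    rw [← Real.exp_add, Real.exp_le_exp]
    nlinarith [sq_nonneg (‖w‖ - 1)]
  unfold gaussM
  calc ‖w‖ ^ p * (A * rexp (-‖w‖ ^ 2 / 2)) * (1 + ‖w‖) ^ 7
      ≤ (1 + ‖w‖) ^ 2 * (A * rexp (-‖w‖ ^ 2 / 2)) * (1 + ‖w‖) ^ 7 := by gcongr
    _ = A * ((1 + ‖w‖) ^ 9 * rexp (-‖w‖ ^ 2 / 2)) := by ring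
    _ ≤ A * (Nat.factorial 9 * rexp (1 + ‖w‖) * rexp (-‖w‖ ^ 2 / 2)) := by gcongr
    _ = A * (Nat.factorial 9 * (rexp (1 + ‖w‖) * rexp (-‖w‖ ^ 2 / 2))) := by ring
    _ ≤ A * (Nat.factorial 9 * rexp (3 / 2)) := by gcongr

section GaussianMoments

variable {β : ℝ}

theorem integrable_norm_sub_rpow_mul_gaussM (hβ : -3 < β) (hβ0 : β ≤ 0) {p : ℕ} (hp : p ≤ 2)
    (v : V3) : Integrable (fun w => ‖v - w‖ ^ β * (‖w‖ ^ p * gaussM w)) := by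
  obtain ⟨C, hC⟩ := exists_gaussM_decay
  exact integrable_riesz hβ hβ0 (by fun_prop) (hC p hp) v

theorem tendsto_norm_sub_rpow_mul_gaussM (hβ : -3 < β) (hβ0 : β ≤ 0) {p : ℕ} (hp : p ≤ 2) :
    Tendsto (fun v : V3 => ‖v‖ ^ (-β) * ∫ w, ‖v - w‖ ^ β * (‖w‖ ^ p * gaussM w))
      normAtTop (𝓝 (∫ w : V3, ‖w‖ ^ p * gaussM w)) := by
  obtain ⟨C, hC⟩ := exists_gaussM_decay
  exact tendsto_riesz hβ hβ0 (by fun_prop) (hC p hp)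

theorem integrable_Jfun (hβ : -3 < β) (hβ0 : β ≤ 0) (v : V3) :
    Integrable (fun w => ‖v - w‖ ^ β * gaussM w) := by
  simpa using integrable_norm_sub_rpow_mul_gaussM hβ hβ0 (Nat.zero_le 2) v

theorem tendsto_Jfun (hβ : -3 < β) (hβ0 : β ≤ 0) :
    Tendsto (fun v : V3 => ‖v‖ ^ (-β) * Jfun β v) normAtTop (𝓝 1) := by
  have h := tendsto_norm_sub_rpow_mul_gaussM hβ hβ0 (Nat.zero_le 2)
  simpa [integral_gaussM, Jfun] using h

end GaussianMoments

section LandauCoefficients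

variable {γ : ℝ}

theorem abs_apply_le_norm (z : V3) (i : Fin 3) : |z i| ≤ ‖z‖ := by
  simpa using PiLp.norm_apply_le z i

theorem sum_mul_eq_inner (v w : V3) : ∑ i, v i * w i = inner ℝ v w := by
  simp [PiLp.inner_apply, mul_comm]

theorem sum_mul_self_eq (v : V3) : ∑ i, v i * v i = ‖v‖ ^ 2 := by
  rw [sum_mul_eq_inner, real_inner_self_eq_norm_sq]

theorem abs_aker_le (z : V3) (i j : Fin 3) : |aker γ z i j| ≤ 2 * ‖z‖ ^ (γ + 2) := by
  unfold aker
  rw [abs_mul, abs_of_nonneg (by positivity), mul_comm]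
  gcongr
  have h1 : |z i * z j / ‖z‖ ^ 2| ≤ 1 := by
    rw [abs_div, abs_mul, abs_of_nonneg (by positivity : 0 ≤ ‖z‖ ^ 2), sq]
    exact div_le_one_of_le₀ (mul_le_mul (abs_apply_le_norm z i) (abs_apply_le_norm z j)
      (abs_nonneg _) (norm_nonneg _)) (by positivity)
  have h2 : |(if i = j then (1 : ℝ) else 0)| ≤ 1 := by split_ifs <;> simp
  have := abs_sub (if i = j then (1 : ℝ) else 0) (z i * z j / ‖z‖ ^ 2)
  linarith

theorem integrable_aker (hγ : γ ∈ Set.Ioo (-3 : ℝ) (-2)) (v : V3) (i j : Fin 3) :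
    Integrable (fun w => aker γ (v - w) i j * gaussM w) := by
  refine ((integrable_Jfun (β := γ + 2) (by linarith [hγ.1]) (by linarith [hγ.2]) v).const_mul
    2).mono' ?_ (ae_of_all _ fun w => ?_)
  · unfold aker
    exact Measurable.aestronglyMeasurable (by fun_prop)
  · rw [norm_mul, Real.norm_eq_abs, Real.norm_of_nonneg (gaussM_nonneg w), ← mul_assoc]
    exact mul_le_mul_of_nonneg_right (abs_aker_le _ i j) (gaussM_nonneg w)

theorem abs_bker_le (z : V3) (i : Fin 3) :
    |bker γ z i| ≤ 2 * ‖z‖ ^ (γ + 1) := by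
  unfold bker
  rcases eq_or_ne z 0 with rfl | hz
  · simp; positivity
  · rw [Real.rpow_add (norm_pos_iff.2 hz), Real.rpow_one, abs_mul, abs_mul,
      abs_of_nonneg (by positivity : 0 ≤ ‖z‖ ^ γ), ← mul_assoc]
    norm_num
    exact mul_le_mul_of_nonneg_left (abs_apply_le_norm z i) (by positivity)

theorem integrable_bker (hγ : γ ∈ Set.Ioo (-3 : ℝ) (-2)) (v : V3) (i : Fin 3) :
    Integrable (fun w => bker γ (v - w) i * gaussM w) := by
  refine ((integrable_Jfun (β := γ + 1) (by linarith [hγ.1]) (by linarith [hγ.2]) v).const_mul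
    2).mono' ?_ (ae_of_all _ fun w => ?_)
  · unfold bker
    exact Measurable.aestronglyMeasurable (by fun_prop)
  · rw [norm_mul, Real.norm_eq_abs, Real.norm_of_nonneg (gaussM_nonneg w), ← mul_assoc]
    exact mul_le_mul_of_nonneg_right (abs_bker_le _ i) (gaussM_nonneg w)

theorem sum_abar_diag (hγ : γ ∈ Set.Ioo (-3 : ℝ) (-2)) (v : V3) :
    ∑ i, abar γ v i i = 2 * Jfun (γ + 2) v := by
  unfold abar Jfun
  rw [← integral_finsetSum _ fun i _ => integrable_aker hγ v i i, ← integral_const_mul]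
  congr 1 with w
  rw [← Finset.sum_mul, ← mul_assoc]
  congr 1
  rcases eq_or_ne (v - w) 0 with hz | hz
  · simp [aker, hz, Real.zero_rpow (by linarith [hγ.2] : γ + 2 ≠ 0)]
  · simp only [aker, if_true, ← Finset.mul_sum, Finset.sum_sub_distrib, ← Finset.sum_div,
      sum_mul_self_eq]
    rw [div_self (by positivity)]
    simp
    ring

theorem sum_aker_mul_mul (z v : V3) :
    ∑ i, ∑ j, aker γ z i j * v i * v j =
      ‖z‖ ^ (γ + 2) * (‖v‖ ^ 2 - (inner ℝ z v) ^ 2 / ‖z‖ ^ 2) := by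
  rw [← sum_mul_self_eq v, ← sum_mul_eq_inner z v]
  simp only [aker, Fin.sum_univ_three]
  simp
  ring

theorem sum_aker_mul_mul_nonneg (z v : V3) : 0 ≤ ∑ i, ∑ j, aker γ z i j * v i * v j := by
  rw [sum_aker_mul_mul]
  refine mul_nonneg (by positivity) (sub_nonneg.2 (div_le_of_le_mul₀ (by positivity)
    (by positivity) ?_))
  rw [← mul_pow, mul_comm]
  exact sq_le_sq.2 (by rw [abs_of_nonneg (by positivity : 0 ≤ ‖z‖ * ‖v‖)]
                       exact abs_real_inner_le_norm z v)

theorem sum_aker_mul_mul_le (hγ : γ ∈ Set.Ioo (-3 : ℝ) (-2)) (v w : V3) :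
    ∑ i, ∑ j, aker γ (v - w) i j * v i * v j ≤ ‖v‖ ^ 2 * (‖v - w‖ ^ γ * ‖w‖ ^ 2) := by
  rw [sum_aker_mul_mul]
  rcases eq_or_ne (v - w) 0 with hz | hz
  · rw [hz, norm_zero, Real.zero_rpow (by linarith [hγ.2] : γ + 2 ≠ 0), zero_mul]
    positivity
  · have hz' := norm_pos_iff.2 hz
    rw [Real.rpow_add hz', show (2 : ℝ) = ((2 : ℕ) : ℝ) by norm_num, Real.rpow_natCast]
    have e : ‖v - w‖ ^ γ * ‖v - w‖ ^ 2 * (‖v‖ ^ 2 - inner ℝ (v - w) v ^ 2 / ‖v - w‖ ^ 2) =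
        ‖v - w‖ ^ γ * (‖v - w‖ ^ 2 * ‖v‖ ^ 2 - inner ℝ (v - w) v ^ 2) := by
      field_simp
    rw [e, mul_left_comm]
    refine mul_le_mul_of_nonneg_left ?_ (by positivity)
    rw [norm_sub_sq_real, inner_sub_left, real_inner_self_eq_norm_sq, real_inner_comm w v]
    nlinarith [sq_nonneg (inner ℝ w v : ℝ)]

theorem sum_abar_mul_mul (hγ : γ ∈ Set.Ioo (-3 : ℝ) (-2)) (v : V3) :
    ∑ i, ∑ j, abar γ v i j * v i * v j =
      ∫ w, (∑ i, ∑ j, aker γ (v - w) i j * v i * v j) * gaussM w := by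
  have hI : ∀ i j, Integrable (fun w => aker γ (v - w) i j * v i * v j * gaussM w) := fun i j =>
    ((integrable_aker hγ v i j).mul_const (v i * v j)).congr (ae_of_all _ fun w => by ring)
  simp_rw [Finset.sum_mul]
  rw [integral_finsetSum _ fun i _ => integrable_finsetSum _ fun j _ => hI i j]
  refine Finset.sum_congr rfl fun i _ => ?_
  rw [integral_finsetSum _ fun j _ => hI i j]
  refine Finset.sum_congr rfl fun j _ => ?_
  rw [abar, mul_assoc, ← integral_mul_const]
  congr 1 with w
  ring

theorem norm_rpow_mul_inner_mul_gaussM_le (γ : ℝ) (v w : V3) :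
    ‖‖v - w‖ ^ γ * (inner ℝ v w * gaussM w)‖ ≤
      ‖v‖ * (‖v - w‖ ^ γ * (‖w‖ ^ 1 * gaussM w)) := by
  rw [norm_mul, norm_mul, Real.norm_of_nonneg (by positivity : 0 ≤ ‖v - w‖ ^ γ),
    Real.norm_of_nonneg (gaussM_nonneg w), pow_one, mul_left_comm ‖v‖, ← mul_assoc ‖v‖]
  exact mul_le_mul_of_nonneg_left (mul_le_mul_of_nonneg_right (norm_inner_le_norm v w)
    (gaussM_nonneg w)) (by positivity)

theorem sum_bbar_mul (hγ : γ ∈ Set.Ioo (-3 : ℝ) (-2)) (v : V3) :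
    ∑ i, bbar γ v i * v i =
      -2 * ‖v‖ ^ 2 * Jfun γ v + 2 * ∫ w, ‖v - w‖ ^ γ * (inner ℝ v w * gaussM w) := by
  have hI : Integrable (fun w => ‖v - w‖ ^ γ * (inner ℝ v w * gaussM w)) := by
    have h := (integrable_norm_sub_rpow_mul_gaussM hγ.1 (by linarith [hγ.2]) one_le_two v).const_mul
      ‖v‖
    refine h.mono' (Measurable.aestronglyMeasurable (by fun_prop))
      (ae_of_all _ (norm_rpow_mul_inner_mul_gaussM_le γ v))
  have hJ := integrable_Jfun hγ.1 (by linarith [hγ.2]) v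
  unfold bbar Jfun
  simp_rw [← integral_mul_const]
  rw [← integral_finsetSum _ fun i _ => (integrable_bker hγ v i).mul_const _,
    ← integral_const_mul, ← integral_const_mul, ← integral_add (hJ.const_mul _) (hI.const_mul _)]
  congr 1 with w
  rw [← sum_mul_self_eq v, ← sum_mul_eq_inner v w]
  simp only [bker, Fin.sum_univ_three]
  simp
  ring

theorem tendsto_sum_abar_mul_mul (hγ : γ ∈ Set.Ioo (-3 : ℝ) (-2)) :
    Tendsto (fun v : V3 => ‖v‖ ^ (-γ) * (∑ i, ∑ j, abar γ v i j * v i * v j) / ‖v‖ ^ 4)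
      normAtTop (𝓝 0) := by
  have hK := tendsto_norm_sub_rpow_mul_gaussM hγ.1 (by linarith [hγ.2]) (le_refl 2)
  have hr : Tendsto (fun v : V3 => (‖v‖ ^ 2)⁻¹) normAtTop (𝓝 0) :=
    ((tendsto_pow_atTop two_ne_zero).comp tendsto_norm_normAtTop).inv_tendsto_atTop
  have hlim := hK.mul hr
  rw [mul_zero] at hlim
  have hnn : ∀ v w : V3, 0 ≤ (∑ i, ∑ j, aker γ (v - w) i j * v i * v j) * gaussM w := fun v w =>
    mul_nonneg (sum_aker_mul_mul_nonneg _ v) (gaussM_nonneg w)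
  refine squeeze_zero' (Eventually.of_forall fun v => ?_) ?_ hlim
  · rw [sum_abar_mul_mul hγ]
    exact div_nonneg (mul_nonneg (by positivity) (integral_nonneg (hnn v))) (by positivity)
  · filter_upwards [tendsto_norm_normAtTop.eventually_gt_atTop 0] with v hv
    have hle : ∑ i, ∑ j, abar γ v i j * v i * v j ≤
        ‖v‖ ^ 2 * ∫ w, ‖v - w‖ ^ γ * (‖w‖ ^ 2 * gaussM w) := by
      rw [sum_abar_mul_mul hγ, ← integral_const_mul]
      refine integral_mono_of_nonneg (ae_of_all _ (hnn v))
        ((integrable_norm_sub_rpow_mul_gaussM hγ.1 (by linarith [hγ.2]) le_rfl v).const_mul _)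
        (ae_of_all _ fun w => ?_)
      calc _ ≤ ‖v‖ ^ 2 * (‖v - w‖ ^ γ * ‖w‖ ^ 2) * gaussM w :=
            mul_le_mul_of_nonneg_right (sum_aker_mul_mul_le hγ v w) (gaussM_nonneg w)
        _ = _ := by ring
    calc _ ≤ ‖v‖ ^ (-γ) * (‖v‖ ^ 2 * ∫ w, ‖v - w‖ ^ γ * (‖w‖ ^ 2 * gaussM w)) / ‖v‖ ^ 4 := by
          gcongr
      _ = _ := by field_simp

theorem tendsto_sum_bbar_mul (hγ : γ ∈ Set.Ioo (-3 : ℝ) (-2)) :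
    Tendsto (fun v : V3 => ‖v‖ ^ (-γ) * (∑ i, bbar γ v i * v i) / ‖v‖ ^ 2)
      normAtTop (𝓝 (-2)) := by
  have hJ := (tendsto_Jfun hγ.1 (by linarith [hγ.2])).const_mul (-2)
  have hK := tendsto_norm_sub_rpow_mul_gaussM hγ.1 (by linarith [hγ.2]) one_le_two
  have hlim := (hK.mul tendsto_norm_normAtTop.inv_tendsto_atTop)
  rw [mul_zero] at hlim
  have hE : Tendsto (fun v : V3 => ‖v‖ ^ (-γ) *
      (∫ w, ‖v - w‖ ^ γ * (inner ℝ v w * gaussM w)) / ‖v‖ ^ 2) normAtTop (𝓝 0) := by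
    refine squeeze_zero_norm' ?_ hlim
    filter_upwards [tendsto_norm_normAtTop.eventually_gt_atTop 0] with v hv
    have hle : ‖∫ w, ‖v - w‖ ^ γ * (inner ℝ v w * gaussM w)‖ ≤
        ‖v‖ * ∫ w, ‖v - w‖ ^ γ * (‖w‖ ^ 1 * gaussM w) := by
      rw [← integral_const_mul]
      refine norm_integral_le_of_norm_le
        ((integrable_norm_sub_rpow_mul_gaussM hγ.1 (by linarith [hγ.2]) one_le_two v).const_mul _)
        (ae_of_all _ (norm_rpow_mul_inner_mul_gaussM_le γ v))
    rw [norm_div, norm_mul, Real.norm_of_nonneg (by positivity : 0 ≤ ‖v‖ ^ (-γ)),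
      Real.norm_of_nonneg (by positivity : 0 ≤ ‖v‖ ^ 2)]
    calc _ ≤ ‖v‖ ^ (-γ) * (‖v‖ * ∫ w, ‖v - w‖ ^ γ * (‖w‖ ^ 1 * gaussM w)) / ‖v‖ ^ 2 := by
          gcongr
      _ = _ := by simp only [Pi.inv_apply]; field_simp
  have h := hJ.add (hE.const_mul 2)
  norm_num at h
  refine h.congr' ?_
  filter_upwards [tendsto_norm_normAtTop.eventually_gt_atTop 0] with v hv
  rw [sum_bbar_mul hγ]
  field_simp

theorem tendsto_Jfun_add_two (hγ : γ ∈ Set.Ioo (-3 : ℝ) (-2)) :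
    Tendsto (fun v : V3 => ‖v‖ ^ (-γ) * Jfun (γ + 2) v / ‖v‖ ^ 2) normAtTop (𝓝 1) := by
  refine (tendsto_Jfun (β := γ + 2) (by linarith [hγ.1]) (by linarith [hγ.2])).congr' ?_
  filter_upwards [tendsto_norm_normAtTop.eventually_gt_atTop 0] with v hv
  rw [neg_add, Real.rpow_add hv, Real.rpow_neg hv.le 2, Real.rpow_two]
  ring

end LandauCoefficients

section JapaneseBracket

theorem jap_pos (v : V3) : 0 < jap v := by
  unfold jap; positivity

theorem jap_rpow (s : ℝ) (v : V3) : jap v ^ s = (1 + ‖v‖ ^ 2) ^ (s / 2) := by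
  rw [jap, Real.sqrt_eq_rpow, ← Real.rpow_mul (by positivity)]
  congr 1
  ring

theorem hasFDerivAt_jap_rpow (s : ℝ) (v : V3) :
    HasFDerivAt (fun w => jap w ^ s) ((s * jap v ^ (s - 2)) • innerSL ℝ v) v := by
  simp_rw [jap_rpow]
  have h := (((hasStrictFDerivAt_norm_sq v).hasFDerivAt).const_add 1).rpow_const (p := s / 2)
    (Or.inl (by positivity))
  refine h.congr_fderiv ?_
  ext w
  simp only [smul_apply, smul_eq_mul, ← Nat.cast_smul_eq_nsmul ℝ]
  rw [show (s - 2) / 2 = s / 2 - 1 by ring]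
  push_cast
  ring

theorem pd_jap_rpow (s : ℝ) (i : Fin 3) (v : V3) :
    pd i (fun w => jap w ^ s) v = s * jap v ^ (s - 2) * v i := by
  rw [pd, (hasFDerivAt_jap_rpow s v).fderiv]
  simp [EuclideanSpace.inner_single_right]

theorem pd_pd_jap_rpow (s : ℝ) (i j : Fin 3) (v : V3) :
    pd i (pd j (fun w => jap w ^ s)) v =
      s * jap v ^ (s - 2) * (if i = j then 1 else 0) +
        s * (s - 2) * jap v ^ (s - 4) * v i * v j := by
  have e : pd j (fun w => jap w ^ s) = fun w => s * (jap w ^ (s - 2) * w j) := by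
    ext w
    rw [pd_jap_rpow, mul_assoc]
  have h := ((hasFDerivAt_jap_rpow (s - 2) v).mul
    (EuclideanSpace.proj (𝕜 := ℝ) j).hasFDerivAt).const_mul s
  rw [e, pd]
  erw [h.fderiv]
  rw [show s - 2 - 2 = s - 4 by ring]
  by_cases hij : i = j
  · subst hij
    simp [EuclideanSpace.inner_single_right]
    ring
  · simp [hij, Ne.symm hij, EuclideanSpace.inner_single_right]
    ring

theorem jap_rpow_sub_div (s : ℝ) (n : ℕ) (v : V3) :
    jap v ^ (s - n) / jap v ^ s = (jap v ^ n)⁻¹ := by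
  rw [← Real.rpow_sub (jap_pos v), sub_sub_cancel_left, Real.rpow_neg (jap_pos v).le,
    Real.rpow_natCast]

theorem pd_jap_rpow_div (s : ℝ) (i : Fin 3) (v : V3) :
    pd i (fun w => jap w ^ s) v / jap v ^ s = s * (jap v ^ 2)⁻¹ * v i := by
  rw [pd_jap_rpow, ← jap_rpow_sub_div s 2 v]
  push_cast
  ring

theorem pd_pd_jap_rpow_div (s : ℝ) (i j : Fin 3) (v : V3) :
    pd i (pd j (fun w => jap w ^ s)) v / jap v ^ s =
      s * (jap v ^ 2)⁻¹ * (if i = j then 1 else 0) +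
        s * (s - 2) * (jap v ^ 4)⁻¹ * v i * v j := by
  rw [pd_pd_jap_rpow, ← jap_rpow_sub_div s 2 v, ← jap_rpow_sub_div s 4 v]
  push_cast
  ring

theorem tendsto_norm_div_jap : Tendsto (fun v : V3 => ‖v‖ / jap v) normAtTop (𝓝 1) := by
  have hr : Tendsto (fun v : V3 => (‖v‖ ^ 2)⁻¹) normAtTop (𝓝 0) :=
    ((tendsto_pow_atTop two_ne_zero).comp tendsto_norm_normAtTop).inv_tendsto_atTop
  have h := ((hr.add_const 1).sqrt).inv₀ (by simp)
  simp only [zero_add, Real.sqrt_one, inv_one] at h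
  refine h.congr' ?_
  filter_upwards [tendsto_norm_normAtTop.eventually_gt_atTop 0] with v hv
  rw [show (‖v‖ ^ 2)⁻¹ + 1 = (1 + ‖v‖ ^ 2) / ‖v‖ ^ 2 by field_simp,
    Real.sqrt_div' _ (by positivity), Real.sqrt_sq hv.le, inv_div, jap]

end JapaneseBracket

theorem zetaT_jap_rpow (γ k : ℝ) (v : V3) :
    zetaT γ (fun w => jap w ^ k) v =
      k ^ 2 * ((∑ i, ∑ j, abar γ v i j * v i * v j) / jap v ^ 4)
        + k * ((∑ i, bbar γ v i * v i) / jap v ^ 2) + (γ + 3) * Jfun γ v := by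
  simp only [zetaT, mul_div_assoc, pd_jap_rpow_div, cbar, Fin.sum_univ_three]
  ring

theorem zetaMW_jap_rpow {γ : ℝ} (hγ : γ ∈ Set.Ioo (-3 : ℝ) (-2)) (k α : ℝ) (v : V3) :
    zetaMW γ (fun w => jap w ^ k) (fun w => jap w ^ α) v =
      (α * (α - 2) + α ^ 2 - 2 * α * k) * ((∑ i, ∑ j, abar γ v i j * v i * v j) / jap v ^ 4)
        + 2 * α * (Jfun (γ + 2) v / jap v ^ 2) := by
  have h : 2 * α * (Jfun (γ + 2) v / jap v ^ 2) = α * (∑ i, abar γ v i i) / jap v ^ 2 := by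
    rw [sum_abar_diag hγ]; ring
  rw [h]
  simp only [zetaMW, mul_div_assoc, pd_jap_rpow_div, pd_pd_jap_rpow_div, Fin.sum_univ_three]
  simp
  ring

theorem tendsto_zetaT_add_zetaMW {γ : ℝ} (hγ : γ ∈ Set.Ioo (-3 : ℝ) (-2)) (k α : ℝ) :
    Tendsto
      (fun v : V3 =>
        (zetaT γ (fun w => jap w ^ k) v
          + zetaMW γ (fun w => jap w ^ k) (fun w => jap w ^ α) v) * jap v ^ (-γ))
      normAtTop (𝓝 (2 * ((γ + 3) / 2 + α - k))) := by
  have hA := tendsto_sum_abar_mul_mul hγ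
  have hB := tendsto_sum_bbar_mul hγ
  have hJ := tendsto_Jfun hγ.1 (by linarith [hγ.2])
  have hJ2 := tendsto_Jfun_add_two hγ
  have hq := tendsto_norm_div_jap
  have h := (((((hA.mul (hq.pow 4)).const_mul (k ^ 2 + (α * (α - 2) + α ^ 2 - 2 * α * k))).add
    ((hB.mul (hq.pow 2)).const_mul k)).add (hJ.const_mul (γ + 3))).add
    ((hJ2.mul (hq.pow 2)).const_mul (2 * α))).mul (hq.rpow_const (p := γ) (Or.inl one_ne_zero))
  have e : 2 * ((γ + 3) / 2 + α - k) =
      ((k ^ 2 + (α * (α - 2) + α ^ 2 - 2 * α * k)) * (0 * 1 ^ 4) + k * (-2 * 1 ^ 2)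
        + (γ + 3) * 1 + 2 * α * (1 * 1 ^ 2)) * 1 ^ γ := by
    rw [Real.one_rpow]; ring
  rw [e]
  refine h.congr' ?_
  filter_upwards [tendsto_norm_normAtTop.eventually_gt_atTop 0] with v hv
  have hj := jap_pos v
  rw [zetaT_jap_rpow, zetaMW_jap_rpow hγ, Real.div_rpow hv.le hj.le, Real.rpow_neg hv.le,
    Real.rpow_neg hj.le]
  have h1 : ‖v‖ ^ γ ≠ 0 := by positivity
  have h2 : jap v ^ γ ≠ 0 := by positivity
  field_simp
  ring

/-- Lemma 2.2 (1), second part: for m = ⟨v⟩^k, ω = ⟨v⟩^α with 0 ≤ α < k − (γ+3)/2,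
limsup_{|v|→∞} (ζ̃_m(v) + ζ_{m,ω}(v))⟨v⟩^{−γ} ≤ 2((γ+3)/2 + α − k). -/
theorem stmt7 (γ k α : ℝ) (hγ : γ ∈ Set.Ioo (-3 : ℝ) (-2)) (hk : (γ + 3) / 2 < k)
    (hα0 : 0 ≤ α) (hα : α < k - (γ + 3) / 2) :
    Filter.limsup
      (fun v : V3 =>
        (zetaT γ (fun w => jap w ^ k) v
          + zetaMW γ (fun w => jap w ^ k) (fun w => jap w ^ α) v) * jap v ^ (-γ))
      normAtTop ≤ 2 * ((γ + 3) / 2 + α - k) := by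
  exact (tendsto_zetaT_add_zetaMW hγ k α).limsup_eq.le
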